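/- arXiv:2304.00588 — 3 statements merged into one kernel-verified Lean document; each statement's English description precedes it below -/
import Mathlib

section
/- For all natural numbers m > 0 and n ≥ 0, the extended Grundy value of the component bulb^n ++ socket^m is: n if m is even, and n+1 if m is odd. In particular this value is always finite. -/
/-- A piece of a Christmas lights' fixture: a (broken-but-replaceable) bulb
or a (broken) socket. -/
inductive Piece : Type
  | bulb : Piece
  | socket : Piece
  deriving DecidableEq

/-- A component is a finite list of pieces; index 0 is nearest the plug. -/
abbrev Component := List Piece

/-- A sequence of `n` bulbs. -/
def bulbs (n : ℕ) : Component := List.replicate n Piece.bulb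

/-- A sequence of `m` sockets. -/
def sockets (m : ℕ) : Component := List.replicate m Piece.socket

/-- The entries at positions `i-1` and `i+1` both exist and both equal bulb. -/
def Sandwiched (L : Component) (i : ℕ) : Prop :=
  0 < i ∧ L[i-1]? = some Piece.bulb ∧ L[i+1]? = some Piece.bulb

/-- `L'` is obtained from `L` by a quiet move: either fix a bulb (truncating
everything to its right), or remove a socket that is not sandwiched between
two bulbs. -/
def QuietOption (L L' : Component) : Prop :=
  (∃ i, L[i]? = some Piece.bulb ∧ L' = L.take i) ∨
  (∃ i, L[i]? = some Piece.socket ∧ ¬ Sandwiched L i ∧ L' = L.eraseIdx i)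

/-- `L'` is obtained from `L` by a carry-on move: remove a socket sandwiched
between two bulbs (the mover must move again). -/
def CarryOption (L L' : Component) : Prop :=
  ∃ i, L[i]? = some Piece.socket ∧ Sandwiched L i ∧ L' = L.eraseIdx i

/-- A position is a finite multiset of components. -/
abbrev Position := Multiset Component

/-- Total number of pieces in a position. -/
def Position.size (pos : Position) : ℕ := (pos.map List.length).sum

/-- Fuel-indexed winning predicate; `WinN n pos` agrees with the intended
`Win pos` whenever `n ≥ Position.size pos`, since every move strictly
decreases the total number of pieces. -/
def WinN : ℕ → Position → Prop
  | 0, _ => False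
  | n+1, pos =>
      (∃ L ∈ pos, ∃ L', QuietOption L L' ∧ ¬ WinN n (L' ::ₘ pos.erase L)) ∨
      (∃ L ∈ pos, ∃ L', CarryOption L L' ∧ WinN n (L' ::ₘ pos.erase L))

/-- The player to move wins `pos` (normal play convention): some quiet move
leads to a losing position for the opponent, or some carry-on move leads to a
position the mover (still to move) wins. -/
def Win (pos : Position) : Prop := WinN (Position.size pos) pos

open Classical in
/-- Fuel-indexed extended Grundy value; `gN n L` agrees with the intended
value whenever `n ≥ L.length`, since every option of `L` is strictly
shorter. -/
noncomputable def gN : ℕ → Component → ℕ∞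
  | 0, _ => 0
  | n+1, L =>
      let S : Set ℕ := {k | ∃ L', QuietOption L L' ∧ gN n L' = (k : ℕ∞)}
      let C : Set ℕ∞ := {v | ∃ L', CarryOption L L' ∧ gN n L' = v}
      if (⊤ : ℕ∞) ∈ C ∨ (∃ a ∈ C, ∃ b ∈ C, a ≠ b) ∨
          (∃ k : ℕ, C = {(k : ℕ∞)} ∧ k ∈ S) then ⊤
      else if h : ∃ k : ℕ, C = {(k : ℕ∞)} ∧ k ∉ S then (h.choose : ℕ∞)
      else ((sInf {k : ℕ | k ∉ S} : ℕ) : ℕ∞)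

/-- The extended Grundy value `g L ∈ ℕ ∪ {∞}` of a component. -/
noncomputable def g (L : Component) : ℕ∞ := gN L.length L

/-- A component is bulb-headed if it is empty or its first piece is a bulb. -/
def BulbHeaded (L : Component) : Prop := L = [] ∨ L.head? = some Piece.bulb

theorem bulbs_append_sockets_getElem?_bulb {n m i : ℕ} :
    (bulbs n ++ sockets m)[i]? = some Piece.bulb ↔ i < n := by
  simp only [bulbs, sockets, List.getElem?_append, List.getElem?_replicate,
    List.length_replicate]
  grind

theorem bulbs_append_sockets_getElem?_socket {n m i : ℕ} :
    (bulbs n ++ sockets m)[i]? = some Piece.socket ↔ n ≤ i ∧ i < n + m := by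
  simp only [bulbs, sockets, List.getElem?_append, List.getElem?_replicate,
    List.length_replicate]
  grind

theorem not_sandwiched_bulbs_append_sockets {n m i : ℕ} (hi : n ≤ i) :
    ¬ Sandwiched (bulbs n ++ sockets m) i := by
  rintro ⟨-, -, h⟩
  rw [bulbs_append_sockets_getElem?_bulb] at h
  omega

theorem not_carryOption_bulbs_append_sockets {n m : ℕ} (L : Component) :
    ¬ CarryOption (bulbs n ++ sockets m) L := by
  rintro ⟨i, hi, hs, -⟩
  exact not_sandwiched_bulbs_append_sockets
    (bulbs_append_sockets_getElem?_socket.1 hi).1 hs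

theorem take_bulbs_append_sockets {n m i : ℕ} (hi : i < n) :
    (bulbs n ++ sockets m).take i = bulbs i ++ sockets 0 := by
  simp [bulbs, sockets, List.take_append, List.take_replicate, hi.le,
    Nat.sub_eq_zero_of_le hi.le]

theorem eraseIdx_bulbs_append_sockets {n m i : ℕ} (hn : n ≤ i) (hi : i < n + (m + 1)) :
    (bulbs n ++ sockets (m + 1)).eraseIdx i = bulbs n ++ sockets m := by
  have h : i - n < m + 1 := by omega
  rw [List.eraseIdx_append_of_length_le (by simpa [bulbs] using hn)]
  simp [bulbs, sockets, List.eraseIdx_replicate, h]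

theorem quietOption_bulbs_append_sockets {n m : ℕ} {L : Component} :
    QuietOption (bulbs n ++ sockets m) L ↔
      (∃ i < n, L = bulbs i ++ sockets 0) ∨
      (∃ k, m = k + 1 ∧ L = bulbs n ++ sockets k) := by
  unfold QuietOption
  simp only [bulbs_append_sockets_getElem?_bulb, bulbs_append_sockets_getElem?_socket]
  constructor
  · rintro (⟨i, hi, rfl⟩ | ⟨i, ⟨hn, hi⟩, -, rfl⟩)
    · exact Or.inl ⟨i, hi, take_bulbs_append_sockets hi⟩
    · obtain ⟨k, rfl⟩ : ∃ k, m = k + 1 := ⟨m - 1, by omega⟩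
      exact Or.inr ⟨k, rfl, eraseIdx_bulbs_append_sockets hn hi⟩
  · rintro (⟨i, hi, rfl⟩ | ⟨k, rfl, rfl⟩)
    · exact Or.inl ⟨i, hi, (take_bulbs_append_sockets hi).symm⟩
    · exact Or.inr ⟨n, ⟨le_rfl, by omega⟩, not_sandwiched_bulbs_append_sockets le_rfl,
        (eraseIdx_bulbs_append_sockets le_rfl (by omega)).symm⟩

/-- Without carry-on options the extended Grundy value is the usual minimal excludant. -/
theorem gN_succ_of_forall_not_carryOption {N : ℕ} {L : Component}
    (h : ∀ L', ¬ CarryOption L L') :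
    gN (N + 1) L =
      ((sInf {k : ℕ | ¬ ∃ L', QuietOption L L' ∧ gN N L' = (k : ℕ∞)} : ℕ) : ℕ∞) := by
  have hC : ∀ k : ℕ, (∅ : Set ℕ∞) ≠ {(k : ℕ∞)} := fun k => (Set.singleton_ne_empty _).symm
  simp [gN, h, hC]

theorem gN_bulbs_append_sockets (N n m : ℕ) (h : n + m ≤ N) :
    gN N (bulbs n ++ sockets m) = ((if Even m then n else n + 1 : ℕ) : ℕ∞) := by
  induction N generalizing n m with
  | zero =>
    obtain ⟨rfl, rfl⟩ : n = 0 ∧ m = 0 := by omega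
    simp [gN]
  | succ N ih =>
    have hS (k : ℕ) : (∃ L', QuietOption (bulbs n ++ sockets m) L' ∧ gN N L' = (k : ℕ∞)) ↔
        k < n ∨ ∃ j, m = j + 1 ∧ k = if Even j then n else n + 1 := by
      simp only [quietOption_bulbs_append_sockets]
      constructor
      · rintro ⟨L', ⟨i, hi, rfl⟩ | ⟨j, rfl, rfl⟩, hL⟩
        · rw [ih i 0 (by omega)] at hL
          have hk : i = k := by simpa using hL
          exact Or.inl (hk ▸ hi)
        · rw [ih n j (by omega)] at hL
          exact Or.inr ⟨j, rfl, (Nat.cast_injective hL).symm⟩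
      · rintro (hk | ⟨j, rfl, rfl⟩)
        · exact ⟨_, Or.inl ⟨k, hk, rfl⟩, by simp [ih k 0 (by omega)]⟩
        · exact ⟨_, Or.inr ⟨j, rfl, rfl⟩, ih n j (by omega)⟩
    rw [gN_succ_of_forall_not_carryOption not_carryOption_bulbs_append_sockets]
    simp only [hS]
    congr 1
    refine IsLeast.csInf_eq ⟨?_, ?_⟩
    · rintro (hk | ⟨j, rfl, hk⟩)
      · split_ifs at hk <;> omega
      · simp only [Nat.even_add_one] at hk
        by_cases hj : Even j <;> simp [hj] at hk
    · intro k hk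
      simp only [Set.mem_ofPred_eq, not_or, not_exists, not_and, not_lt] at hk
      obtain ⟨hnk, hk⟩ := hk
      split_ifs with hm
      · exact hnk
      · obtain ⟨j, rfl⟩ : ∃ j, m = j + 1 :=
          Nat.exists_eq_succ_of_ne_zero fun h0 => hm (h0 ▸ Even.zero)
        have hj : Even j := by simpa [Nat.even_add_one] using hm
        have hkn := hk j rfl
        rw [if_pos hj] at hkn
        omega

/-- For `m > 0`, the extended Grundy value of `bulb^n ++ socket^m`
is `n` if `m` is even and `n+1` if `m` is odd; in particular it is always
finite. -/
theorem stmt1 (m n : ℕ) (hm : 0 < m) :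
    g (bulbs n ++ sockets m) ≠ ⊤ ∧
    g (bulbs n ++ sockets m) =
      (if Even m then ((n : ℕ) : ℕ∞) else ((n + 1 : ℕ) : ℕ∞)) := by
  have h := gN_bulbs_append_sockets (bulbs n ++ sockets m).length n m
    (by simp [bulbs, sockets])
  rw [g, h]
  exact ⟨ENat.natCast_ne_top _, by split_ifs <;> rfl⟩
end

section
/- For all natural numbers k > 0, m > 0 and n > 1, the extended Grundy value of the component bulb^k ++ socket^m ++ bulb^n is: k+n if m is odd; k+n+1 if m is even and n is even; and k+n-1 if m is even and n is odd. In particular this value is always finite. -/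
/-- The offset over `k` of the Grundy value of `bulb^k ++ socket^m ++ bulb^n` when it is finite. -/
def grundyOffset (m n : ℕ) : ℕ :=
  if m = 0 then n
  else if n = 0 then m % 2
  else if n = 1 then (m + 1) % 2
  else if m % 2 = 1 then n
  else if n % 2 = 0 then n + 1
  else n - 1

theorem gN_eq_of_mex {N v : ℕ} {L : Component} (hC : ∀ L', ¬ CarryOption L L')
    (hlt : ∀ w < v, ∃ L', QuietOption L L' ∧ gN N L' = (w : ℕ∞))
    (hne : ∀ L', QuietOption L L' → gN N L' ≠ (v : ℕ∞)) :
    gN (N + 1) L = (v : ℕ∞) := by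
  have hCe : {x : ℕ∞ | ∃ L', CarryOption L L' ∧ gN N L' = x} = ∅ := by
    ext x; simp [hC]
  have hmex : sInf {k : ℕ | k ∉ {k : ℕ | ∃ L', QuietOption L L' ∧ gN N L' = (k : ℕ∞)}} = v := by
    apply IsLeast.csInf_eq
    constructor
    · rintro ⟨L', hL', h⟩
      exact hne L' hL' h
    · intro w hw
      by_contra hlt'
      exact hw (hlt w (not_le.mp hlt'))
  have hemp : ∀ k : ℕ, (∅ : Set ℕ∞) ≠ {(k : ℕ∞)} := fun k =>
    (Set.singleton_ne_empty _).symm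
  simp only [gN]
  rw [if_neg, dif_neg, hmex]
  · rintro ⟨k, hk, -⟩
    exact hemp k (hCe.symm.trans hk)
  · rw [hCe]
    rintro (h | ⟨a, ha, -⟩ | ⟨k, hk, -⟩)
    · exact h
    · exact ha
    · exact hemp k hk

theorem carrySet_eq_singleton {N v : ℕ} {L M : Component} (hC : ∀ L', CarryOption L L' ↔ L' = M)
    (hM : gN N M = (v : ℕ∞)) :
    {x : ℕ∞ | ∃ L', CarryOption L L' ∧ gN N L' = x} = {(v : ℕ∞)} := by
  ext x; simp [hC, hM, eq_comm]

theorem gN_eq_of_carry {N v : ℕ} {L M : Component} (hC : ∀ L', CarryOption L L' ↔ L' = M)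
    (hM : gN N M = (v : ℕ∞)) (hne : ∀ L', QuietOption L L' → gN N L' ≠ (v : ℕ∞)) :
    gN (N + 1) L = (v : ℕ∞) := by
  have hS : v ∉ {k : ℕ | ∃ L', QuietOption L L' ∧ gN N L' = (k : ℕ∞)} := by
    rintro ⟨L', hL', h⟩
    exact hne L' hL' h
  have hCv := carrySet_eq_singleton hC hM
  have hex : ∃ k : ℕ, {x : ℕ∞ | ∃ L', CarryOption L L' ∧ gN N L' = x} = {(k : ℕ∞)} ∧
      k ∉ {k : ℕ | ∃ L', QuietOption L L' ∧ gN N L' = (k : ℕ∞)} := ⟨v, hCv, hS⟩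
  simp only [gN]
  rw [if_neg, dif_pos hex]
  · have := hex.choose_spec.1
    exact (Set.singleton_eq_singleton_iff.mp (hCv.symm.trans this)).symm
  · rw [hCv]
    rintro (h | ⟨a, ha, b, hb, hab⟩ | ⟨k, hk, hkS⟩)
    · simp at h
    · exact hab (ha.trans hb.symm)
    · have : v = k := by simpa using hk
      exact hS (this ▸ hkS)

theorem gN_eq_top_of_carry {N v : ℕ} {L M : Component} (hC : ∀ L', CarryOption L L' ↔ L' = M)
    (hM : gN N M = (v : ℕ∞)) (hS : ∃ L', QuietOption L L' ∧ gN N L' = (v : ℕ∞)) :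
    gN (N + 1) L = ⊤ := by
  simp only [gN]
  exact if_pos (Or.inr (Or.inr ⟨v, carrySet_eq_singleton hC hM, hS⟩))

theorem getElem?_bulbs_sockets_bulbs (k m n i : ℕ) :
    (bulbs k ++ sockets m ++ bulbs n)[i]? =
      if i < k then some Piece.bulb
      else if i < k + m then some Piece.socket
      else if i < k + m + n then some Piece.bulb
      else none := by
  simp only [bulbs, sockets, List.getElem?_append, List.getElem?_replicate, List.length_append,
    List.length_replicate]
  grind

theorem eraseIdx_bulbs_sockets_bulbs {k m n i : ℕ} (hk : k ≤ i) (hi : i < k + m) :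
    (bulbs k ++ sockets m ++ bulbs n).eraseIdx i = bulbs k ++ sockets (m - 1) ++ bulbs n := by
  apply List.ext_getElem?
  intro j
  rw [List.getElem?_eraseIdx]
  simp only [getElem?_bulbs_sockets_bulbs]
  grind

theorem take_bulbs_sockets_bulbs_of_lt {k m n i : ℕ} (hi : i < k) :
    (bulbs k ++ sockets m ++ bulbs n).take i = bulbs i := by
  apply List.ext_getElem?
  intro j
  rw [List.getElem?_take]
  simp only [getElem?_bulbs_sockets_bulbs]
  simp only [bulbs, List.getElem?_replicate]
  grind

theorem take_bulbs_sockets_bulbs_of_le {k m n i : ℕ} (hi : k + m ≤ i) (hn : i < k + m + n) :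
    (bulbs k ++ sockets m ++ bulbs n).take i =
      bulbs k ++ sockets m ++ bulbs (i - (k + m)) := by
  apply List.ext_getElem?
  intro j
  rw [List.getElem?_take]
  simp only [getElem?_bulbs_sockets_bulbs]
  grind

theorem sandwiched_bulbs_sockets_bulbs_iff {k m n i : ℕ} (hk : 0 < k) (hi : k ≤ i)
    (him : i < k + m) :
    Sandwiched (bulbs k ++ sockets m ++ bulbs n) i ↔ m = 1 ∧ 0 < n := by
  simp only [Sandwiched, getElem?_bulbs_sockets_bulbs]
  grind

theorem quietOption_bulbs_sockets_bulbs_iff {k m n : ℕ} (hk : 0 < k) (hm : 0 < m)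
    (L' : Component) :
    QuietOption (bulbs k ++ sockets m ++ bulbs n) L' ↔
      (∃ i < k, L' = bulbs i) ∨
      (∃ j < n, L' = bulbs k ++ sockets m ++ bulbs j) ∨
      (¬ (m = 1 ∧ 0 < n) ∧ L' = bulbs k ++ sockets (m - 1) ++ bulbs n) := by
  constructor
  · rintro (⟨i, hi, rfl⟩ | ⟨i, hi, hs, rfl⟩)
    · rw [getElem?_bulbs_sockets_bulbs] at hi
      by_cases h1 : i < k
      · exact Or.inl ⟨i, h1, take_bulbs_sockets_bulbs_of_lt h1⟩
      · have h2 : k + m ≤ i ∧ i < k + m + n := by grind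
        exact Or.inr (Or.inl ⟨i - (k + m), by omega, take_bulbs_sockets_bulbs_of_le h2.1 h2.2⟩)
    · rw [getElem?_bulbs_sockets_bulbs] at hi
      have h2 : k ≤ i ∧ i < k + m := by grind
      rw [sandwiched_bulbs_sockets_bulbs_iff hk h2.1 h2.2] at hs
      exact Or.inr (Or.inr ⟨hs, eraseIdx_bulbs_sockets_bulbs h2.1 h2.2⟩)
  · rintro (⟨i, hi, rfl⟩ | ⟨j, hj, rfl⟩ | ⟨hs, rfl⟩)
    · refine Or.inl ⟨i, ?_, (take_bulbs_sockets_bulbs_of_lt hi).symm⟩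
      rw [getElem?_bulbs_sockets_bulbs, if_pos hi]
    · refine Or.inl ⟨k + m + j, ?_, ?_⟩
      · rw [getElem?_bulbs_sockets_bulbs]
        grind
      · rw [take_bulbs_sockets_bulbs_of_le (by omega) (by omega), Nat.add_sub_cancel_left]
    · refine Or.inr ⟨k, ?_, ?_, (eraseIdx_bulbs_sockets_bulbs le_rfl (by omega)).symm⟩
      · rw [getElem?_bulbs_sockets_bulbs]
        grind
      · rwa [sandwiched_bulbs_sockets_bulbs_iff hk le_rfl (by omega)]

theorem carryOption_bulbs_sockets_bulbs_iff {k m n : ℕ} (hk : 0 < k) (L' : Component) :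
    CarryOption (bulbs k ++ sockets m ++ bulbs n) L' ↔
      (m = 1 ∧ 0 < n) ∧ L' = bulbs (k + n) := by
  have hmerge : bulbs k ++ sockets (1 - 1) ++ bulbs n = bulbs (k + n) := by
    simp [bulbs, sockets]
  constructor
  · rintro ⟨i, hi, hs, rfl⟩
    rw [getElem?_bulbs_sockets_bulbs] at hi
    have h2 : k ≤ i ∧ i < k + m := by grind
    rw [sandwiched_bulbs_sockets_bulbs_iff hk h2.1 h2.2] at hs
    obtain ⟨rfl, hn⟩ := hs
    exact ⟨⟨rfl, hn⟩, (eraseIdx_bulbs_sockets_bulbs h2.1 h2.2).trans hmerge⟩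
  · rintro ⟨⟨rfl, hn⟩, rfl⟩
    refine ⟨k, ?_, ?_, ((eraseIdx_bulbs_sockets_bulbs le_rfl (by omega)).trans hmerge).symm⟩
    · rw [getElem?_bulbs_sockets_bulbs]
      grind
    · rw [sandwiched_bulbs_sockets_bulbs_iff hk le_rfl (by omega)]
      exact ⟨rfl, hn⟩

theorem getElem?_bulbs_ne_socket (n i : ℕ) : (bulbs n)[i]? ≠ some Piece.socket := by
  simp [bulbs, List.getElem?_replicate]

theorem quietOption_bulbs_iff {n : ℕ} (L' : Component) :
    QuietOption (bulbs n) L' ↔ ∃ i < n, L' = bulbs i := by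
  constructor
  · rintro (⟨i, hi, rfl⟩ | ⟨i, hi, -⟩)
    · have hin : i < n := by
        by_contra h
        simp [bulbs, h] at hi
      exact ⟨i, hin, by simp [bulbs, List.take_replicate, hin.le]⟩
    · exact absurd hi (getElem?_bulbs_ne_socket n i)
  · rintro ⟨i, hi, rfl⟩
    exact Or.inl ⟨i, by simp [bulbs, hi],
      by simp [bulbs, List.take_replicate, hi.le]⟩

theorem gN_bulbs {N n : ℕ} (h : n ≤ N) : gN N (bulbs n) = (n : ℕ∞) := by
  induction N generalizing n with
  | zero =>
    obtain rfl : n = 0 := by omega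
    simp [gN]
  | succ N ih =>
    apply gN_eq_of_mex
    · rintro L' ⟨i, hi, -⟩
      exact getElem?_bulbs_ne_socket n i hi
    · intro w hw
      exact ⟨bulbs w, (quietOption_bulbs_iff _).2 ⟨w, hw, rfl⟩, ih (by omega)⟩
    · intro L' hL'
      obtain ⟨i, hi, rfl⟩ := (quietOption_bulbs_iff _).1 hL'
      rw [ih (by omega)]
      exact_mod_cast hi.ne

/-- Every offset below `grundyOffset m n` is attained at a shorter tail of bulbs or at one socket
less, avoiding the component with infinite value. -/
theorem exists_grundyOffset_eq {m n t : ℕ} (hm : 0 < m) (h1 : ¬ (m = 1 ∧ 0 < n))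
    (ht : t < grundyOffset m n) :
    (∃ j < n, ¬ (m = 1 ∧ j = 1) ∧ grundyOffset m j = t) ∨
      (¬ (m - 1 = 1 ∧ n = 1) ∧ grundyOffset (m - 1) n = t) := by
  unfold grundyOffset at ht
  by_cases hn0 : n = 0
  · right
    unfold grundyOffset
    grind
  have hm2 : 2 ≤ m := by omega
  rcases Nat.mod_two_eq_zero_or_one m with hmod | hmod
  · by_cases htn : t = n
    · right
      unfold grundyOffset
      grind
    · left
      rcases Nat.lt_or_ge t 2 with ht2 | ht2
      · refine ⟨t, by grind, by omega, ?_⟩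
        unfold grundyOffset
        grind
      · rcases Nat.mod_two_eq_zero_or_one t with htm | htm
        · refine ⟨t + 1, by grind, by omega, ?_⟩
          unfold grundyOffset
          grind
        · refine ⟨t - 1, by grind, by omega, ?_⟩
          unfold grundyOffset
          grind
  · left
    rcases Nat.lt_or_ge t 2 with ht2 | ht2
    · refine ⟨1 - t, by grind, by omega, ?_⟩
      unfold grundyOffset
      grind
    · refine ⟨t, by grind, by omega, ?_⟩
      unfold grundyOffset
      grind

theorem gN_bulbs_sockets_bulbs {N k m n : ℕ} (hk : 0 < k) (hN : k + m + n ≤ N) :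
    gN N (bulbs k ++ sockets m ++ bulbs n) =
      if m = 1 ∧ n = 1 then ⊤ else ((k + grundyOffset m n : ℕ) : ℕ∞) := by
  induction N generalizing m n with
  | zero => omega
  | succ N ih =>
    rcases Nat.eq_zero_or_pos m with rfl | hm
    · have hmerge : bulbs k ++ sockets 0 ++ bulbs n = bulbs (k + n) := by
        simp [bulbs, sockets]
      rw [hmerge, gN_bulbs (by omega)]
      simp [grundyOffset]
    by_cases hc : m = 1 ∧ 0 < n
    · obtain ⟨rfl, hn⟩ := hc
      have hC : ∀ L', CarryOption (bulbs k ++ sockets 1 ++ bulbs n) L' ↔ L' = bulbs (k + n) := by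
        intro L'
        rw [carryOption_bulbs_sockets_bulbs_iff hk]
        simp [hn]
      have hM : gN N (bulbs (k + n)) = ((k + n : ℕ) : ℕ∞) := gN_bulbs (by omega)
      by_cases hn1 : n = 1
      · subst hn1
        rw [if_pos ⟨rfl, rfl⟩]
        refine gN_eq_top_of_carry hC hM ⟨bulbs k ++ sockets 1 ++ bulbs 0, ?_, ?_⟩
        · exact (quietOption_bulbs_sockets_bulbs_iff hk one_pos _).2
            (Or.inr (Or.inl ⟨0, one_pos, rfl⟩))
        · rw [ih (by omega)]
          simp [grundyOffset]
      · have hoff : grundyOffset 1 n = n := by simp [grundyOffset, hn1]; omega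
        rw [if_neg (by omega), hoff]
        refine gN_eq_of_carry hC hM fun L' hL' => ?_
        rcases (quietOption_bulbs_sockets_bulbs_iff hk one_pos _).1 hL' with
          ⟨i, hi, rfl⟩ | ⟨j, hj, rfl⟩ | ⟨h, -⟩
        · rw [gN_bulbs (by omega), Ne, Nat.cast_inj]
          omega
        · rw [ih (by omega)]
          split_ifs with hj1
          · exact ENat.top_ne_natCast _
          · rw [Ne, Nat.cast_inj]
            unfold grundyOffset
            grind
        · exact absurd ⟨rfl, hn⟩ h
    · rw [if_neg (by omega)]
      apply gN_eq_of_mex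
      · intro L' hL'
        exact hc ((carryOption_bulbs_sockets_bulbs_iff hk _).1 hL').1
      · intro w hw
        by_cases hwk : w < k
        · exact ⟨bulbs w, (quietOption_bulbs_sockets_bulbs_iff hk hm _).2 (Or.inl ⟨w, hwk, rfl⟩),
            gN_bulbs (by omega)⟩
        · rcases exists_grundyOffset_eq hm hc (t := w - k) (by omega) with ⟨j, hj, hj1, h⟩ | ⟨h1, h⟩
          · refine ⟨_, (quietOption_bulbs_sockets_bulbs_iff hk hm _).2
              (Or.inr (Or.inl ⟨j, hj, rfl⟩)), ?_⟩
            rw [ih (by omega), if_neg hj1, h, Nat.add_sub_cancel' (by omega)]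
          · refine ⟨_, (quietOption_bulbs_sockets_bulbs_iff hk hm _).2
              (Or.inr (Or.inr ⟨hc, rfl⟩)), ?_⟩
            rw [ih (by omega), if_neg h1, h, Nat.add_sub_cancel' (by omega)]
      · intro L' hL'
        rcases (quietOption_bulbs_sockets_bulbs_iff hk hm _).1 hL' with
          ⟨i, hi, rfl⟩ | ⟨j, hj, rfl⟩ | ⟨-, rfl⟩
        · rw [gN_bulbs (by omega), Ne, Nat.cast_inj]
          omega
        · rw [ih (by omega)]
          split_ifs with hj1
          · exact ENat.top_ne_natCast _
          · rw [Ne, Nat.cast_inj]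
            unfold grundyOffset
            grind
        · rw [ih (by omega)]
          split_ifs with hj1
          · exact ENat.top_ne_natCast _
          · rw [Ne, Nat.cast_inj]
            unfold grundyOffset
            grind

/-- For `k > 0`, `m > 0`, `n > 1`, the extended Grundy value of
`bulb^k ++ socket^m ++ bulb^n` is `k+n` if `m` is odd, `k+n+1` if `m` and `n`
are even, and `k+n-1` if `m` is even and `n` is odd; in particular it is
always finite. -/
theorem stmt3 (k m n : ℕ) (hk : 0 < k) (hm : 0 < m) (hn : 1 < n) :
    g (bulbs k ++ sockets m ++ bulbs n) ≠ ⊤ ∧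
    g (bulbs k ++ sockets m ++ bulbs n) =
      (if Odd m then ((k + n : ℕ) : ℕ∞)
       else if Even n then ((k + n + 1 : ℕ) : ℕ∞)
       else ((k + n - 1 : ℕ) : ℕ∞)) := by
  have hval : g (bulbs k ++ sockets m ++ bulbs n) = ((k + grundyOffset m n : ℕ) : ℕ∞) := by
    rw [g, gN_bulbs_sockets_bulbs hk (by simp [bulbs, sockets]; omega), if_neg (by omega)]
  rw [hval]
  refine ⟨ENat.natCast_ne_top _, ?_⟩
  split_ifs with h1 h2 <;> rw [Nat.cast_inj] <;> unfold grundyOffset <;> grind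
end

section
/- Let k ≥ 0 and m ≥ 0 be natural numbers and let X and X' be bulb-headed components with g(X) = g(X') = i for some finite i, and suppose g(bulb^k ++ socket^m ++ X) is finite. Then the two-component position consisting of bulb^k ++ socket^m ++ X and bulb^k ++ socket^m ++ X' is a previous-player win: Win({bulb^k ++ socket^m ++ X, bulb^k ++ socket^m ++ X'}) fails. -/
theorem QuietOption.length_lt {L L' : Component} (h : QuietOption L L') :
    L'.length < L.length := by
  rcases h with ⟨i, hi, rfl⟩ | ⟨i, hi, -, rfl⟩
  all_goals
    have hlt : i < L.length := (List.getElem?_eq_some_iff.1 hi).1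
    first
    | rw [List.length_take]; omega
    | rw [List.length_eraseIdx_of_lt hlt]; omega

theorem CarryOption.length_lt {L L' : Component} (h : CarryOption L L') :
    L'.length < L.length := by
  obtain ⟨i, hi, -, rfl⟩ := h
  have hlt : i < L.length := (List.getElem?_eq_some_iff.1 hi).1
  rw [List.length_eraseIdx_of_lt hlt]
  omega

theorem not_quietOption_nil (Y : Component) : ¬ QuietOption [] Y :=
  fun h => by simpa using h.length_lt

theorem not_carryOption_nil (Y : Component) : ¬ CarryOption [] Y :=
  fun h => by simpa using h.length_lt

open Classical in
/-- The extended Grundy value of a component in terms of the set `S` of finite values of its quiet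
options and the set `C` of values of its carry-on options. -/
noncomputable def extendedMex (S : Set ℕ) (C : Set ℕ∞) : ℕ∞ :=
  if (⊤ : ℕ∞) ∈ C ∨ (∃ a ∈ C, ∃ b ∈ C, a ≠ b) ∨ (∃ k : ℕ, C = {(k : ℕ∞)} ∧ k ∈ S) then ⊤
  else if h : ∃ k : ℕ, C = {(k : ℕ∞)} ∧ k ∉ S then (h.choose : ℕ∞)
  else ((sInf {k : ℕ | k ∉ S} : ℕ) : ℕ∞)

theorem gN_succ (n : ℕ) (L : Component) :
    gN (n + 1) L = extendedMex {k : ℕ | ∃ L', QuietOption L L' ∧ gN n L' = k}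
      {v : ℕ∞ | ∃ L', CarryOption L L' ∧ gN n L' = v} := by
  rw [gN, extendedMex]

theorem gN_eq_of_length_le (n n' : ℕ) (L : Component) (hn : L.length ≤ n) (hn' : L.length ≤ n') :
    gN n L = gN n' L := by
  have nil_eq : ∀ n, gN n [] = 0 := by
    rintro (_ | n)
    · rfl
    · simp [gN_succ, extendedMex, not_quietOption_nil, not_carryOption_nil, Set.ext_iff]
  induction n generalizing n' L with
  | zero =>
    obtain rfl : L = [] := List.length_eq_zero_iff.1 (by omega)
    rw [nil_eq, nil_eq]
  | succ n ih =>
    cases n' with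
    | zero =>
      obtain rfl : L = [] := List.length_eq_zero_iff.1 (by omega)
      rw [nil_eq, nil_eq]
    | succ n' =>
      have hS : {k : ℕ | ∃ L', QuietOption L L' ∧ gN n L' = (k : ℕ∞)} =
          {k : ℕ | ∃ L', QuietOption L L' ∧ gN n' L' = (k : ℕ∞)} := by
        ext k
        refine exists_congr fun L' => and_congr_right fun h => ?_
        have := h.length_lt
        rw [ih n' L' (by omega) (by omega)]
      have hC : {v : ℕ∞ | ∃ L', CarryOption L L' ∧ gN n L' = v} =
          {v : ℕ∞ | ∃ L', CarryOption L L' ∧ gN n' L' = v} := by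
        ext k
        refine exists_congr fun L' => and_congr_right fun h => ?_
        have := h.length_lt
        rw [ih n' L' (by omega) (by omega)]
      rw [gN_succ, gN_succ, hS, hC]

/-- The defining recursion of `g`, free of fuel. -/
theorem g_eq_extendedMex (L : Component) :
    g L = extendedMex {k : ℕ | ∃ L', QuietOption L L' ∧ g L' = k}
      {v : ℕ∞ | ∃ L', CarryOption L L' ∧ g L' = v} := by
  have hg : g L = gN (L.length + 1) L := gN_eq_of_length_le _ _ _ le_rfl (by omega)
  rw [hg, gN_succ]
  congr 1
  all_goals
    ext v
    refine exists_congr fun L' => and_congr_right fun h => ?_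
    rw [g, gN_eq_of_length_le _ L'.length _ h.length_lt.le le_rfl]

theorem exists_carryOption_of_g_eq_top {L : Component} (h : g L = ⊤) :
    ∃ L', CarryOption L L' := by
  by_contra hno
  push Not at hno
  have hne : ∀ k : ℕ, (∅ : Set ℕ∞) ≠ {(k : ℕ∞)} := fun k => (Set.singleton_ne_empty _).symm
  rw [g_eq_extendedMex] at h
  simp [extendedMex, hno, hne] at h

/-- The recursion for finite extended Grundy values. -/
theorem g_eq_coe_iff (L : Component) (n : ℕ) :
    g L = n ↔ (∀ L', CarryOption L L' → g L' = n) ∧ (∀ L', QuietOption L L' → g L' ≠ n) ∧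
      ((∃ L', CarryOption L L') ∨ ∀ j < n, ∃ L', QuietOption L L' ∧ g L' = j) := by
  rw [g_eq_extendedMex, extendedMex]
  set S := {k : ℕ | ∃ L', QuietOption L L' ∧ g L' = (k : ℕ∞)} with hSdef
  set C := {v : ℕ∞ | ∃ L', CarryOption L L' ∧ g L' = v} with hCdef
  have hSfin : S.Finite := by
    have hopt : {L' | QuietOption L L'}.Finite := by
      refine (((Set.finite_lt_nat L.length).image L.take).union
        ((Set.finite_lt_nat L.length).image L.eraseIdx)).subset ?_
      rintro L' (⟨i, hi, rfl⟩ | ⟨i, hi, -, rfl⟩)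
      · exact .inl ⟨i, (List.getElem?_eq_some_iff.1 hi).1, rfl⟩
      · exact .inr ⟨i, (List.getElem?_eq_some_iff.1 hi).1, rfl⟩
    refine (hopt.image fun L' => (g L').toNat).subset ?_
    rintro k ⟨L', h, hk⟩
    exact ⟨L', h, by simp [hk]⟩
  have h1 : (∀ L', CarryOption L L' → g L' = n) ↔ ∀ v ∈ C, v = n := by
    simp [hCdef]
  have h2 : (∀ L', QuietOption L L' → g L' ≠ n) ↔ n ∉ S := by
    simp [hSdef]
  have h3 : (∃ L', CarryOption L L') ↔ C.Nonempty :=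
    ⟨fun ⟨L', h⟩ => ⟨_, L', h, rfl⟩, fun ⟨_, L', h, _⟩ => ⟨L', h⟩⟩
  have h4 : (∀ j < n, ∃ L', QuietOption L L' ∧ g L' = j) ↔ ∀ j < n, j ∈ S := Iff.rfl
  rw [h1, h2, h3, h4]
  clear_value S C
  split_ifs with hinf hsing
  · simp only [ENat.top_ne_natCast, false_iff]
    rintro ⟨hc, hs, -⟩
    rcases hinf with h | ⟨a, ha, b, hb, hab⟩ | ⟨k, rfl, hk⟩
    · simpa using hc _ h
    · exact hab ((hc a ha).trans (hc b hb).symm)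
    · have : k = n := by simpa using hc k rfl
      exact hs (this ▸ hk)
  · have hsp := hsing.choose_spec
    generalize hsing.choose = c at hsp ⊢
    obtain ⟨rfl, hc⟩ := hsp
    constructor
    · intro h
      obtain rfl : c = n := by exact_mod_cast h
      exact ⟨by simp, hc, .inl ⟨_, rfl⟩⟩
    · exact fun h => h.1 _ rfl
  · have hempty : C = ∅ := by
      by_contra hne
      obtain ⟨v, hv⟩ := Set.nonempty_iff_ne_empty.2 hne
      push Not at hinf hsing
      obtain ⟨htop, heq, hk⟩ := hinf
      lift v to ℕ using fun h => htop (h ▸ hv)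
      have hCv : C = {(v : ℕ∞)} := Set.eq_singleton_iff_unique_mem.2
        ⟨hv, fun w hw => heq w hw v hv⟩
      exact hk v hCv (hsing v hCv)
    have hne : {k | k ∉ S}.Nonempty := hSfin.exists_notMem
    have hmem := Nat.sInf_mem hne
    simp only [hempty, Set.mem_empty_iff_false, false_implies, implies_true, true_and,
      Set.not_nonempty_empty, false_or, Nat.cast_inj]
    constructor
    · rintro rfl
      exact ⟨hmem, fun j hj => by simpa using Nat.notMem_of_lt_sInf hj⟩
    · rintro ⟨hn, hlt⟩
      refine le_antisymm (Nat.sInf_le hn) (le_of_not_gt fun h => hmem (hlt _ h))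

/-- A position all of whose moves on the component `L` are bad against a component of value `v`
has `g L` finite and at most `v`. -/
theorem g_le_of_forall_option {L : Component} {v : ℕ∞}
    (hq : ∀ L', QuietOption L L' → g L' = v → g L' = ⊤)
    (hc : ∀ L', CarryOption L L' → g L' = v ∧ g L' ≠ ⊤) : g L ≠ ⊤ ∧ g L ≤ v := by
  have hfin : g L ≠ ⊤ := by
    intro htop
    obtain ⟨L', h⟩ := exists_carryOption_of_g_eq_top htop
    obtain ⟨rfl, hne⟩ := hc L' h
    lift g L' to ℕ using hne with n
    have := (g_eq_coe_iff L n).2 ⟨fun L' h => (hc L' h).1,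
      fun L' h hg => by simpa [hg] using hq L' h hg, .inl ⟨L', h⟩⟩
    simp [htop] at this
  refine ⟨hfin, le_of_not_gt fun hlt => ?_⟩
  lift g L to ℕ using hfin with n hn
  obtain ⟨h1, -, ⟨L', h⟩ | h3⟩ := (g_eq_coe_iff L n).1 hn.symm
  · exact hlt.ne ((hc L' h).1.symm.trans (h1 L' h))
  · lift v to ℕ using hlt.ne_top
    obtain ⟨L', h, hg⟩ := h3 v (by exact_mod_cast hlt)
    simpa [hg] using hq L' h hg

theorem winN_succ_pair (n : ℕ) (A B : Component) :
    WinN (n + 1) {A, B} ↔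
      ((∃ A', QuietOption A A' ∧ ¬ WinN n {A', B}) ∨ ∃ B', QuietOption B B' ∧ ¬ WinN n {A, B'}) ∨
      ((∃ A', CarryOption A A' ∧ WinN n {A', B}) ∨ ∃ B', CarryOption B B' ∧ WinN n {A, B'}) := by
  have hA : ({A, B} : Position).erase A = {B} := Multiset.erase_cons_head _ _
  have hB : ({A, B} : Position).erase B = {A} := by
    rw [Multiset.pair_comm]; exact Multiset.erase_cons_head _ _
  have hswap : ∀ B' : Component, B' ::ₘ ({A} : Position) = {A, B'} :=
    fun B' => Multiset.pair_comm _ _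
  rw [WinN]
  simp only [Multiset.insert_eq_cons, Multiset.mem_cons, Multiset.mem_singleton, or_and_right,
    exists_or, exists_eq_left] at hA hB hswap ⊢
  rw [hA, hB]
  simp only [hswap]

/-- A two-component position is a loss for the player to move exactly when both components
have the same finite extended Grundy value. -/
theorem winN_pair_iff (n : ℕ) (A B : Component) (hn : A.length + B.length ≤ n) :
    WinN n {A, B} ↔ ¬ (g A = g B ∧ g A ≠ ⊤) := by
  induction n generalizing A B with
  | zero =>
    obtain rfl : A = [] := List.length_eq_zero_iff.1 (by omega)
    obtain rfl : B = [] := List.length_eq_zero_iff.1 (by omega)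
    simp [WinN, g, gN]
  | succ n ih =>
    have qA : ∀ A', QuietOption A A' → (WinN n {A', B} ↔ ¬ (g A' = g B ∧ g A' ≠ ⊤)) :=
      fun A' h => ih A' B (by have := h.length_lt; omega)
    have qB : ∀ B', QuietOption B B' → (WinN n {A, B'} ↔ ¬ (g A = g B' ∧ g A ≠ ⊤)) :=
      fun B' h => ih A B' (by have := h.length_lt; omega)
    have cA : ∀ A', CarryOption A A' → (WinN n {A', B} ↔ ¬ (g A' = g B ∧ g A' ≠ ⊤)) :=
      fun A' h => ih A' B (by have := h.length_lt; omega)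
    have cB : ∀ B', CarryOption B B' → (WinN n {A, B'} ↔ ¬ (g A = g B' ∧ g A ≠ ⊤)) :=
      fun B' h => ih A B' (by have := h.length_lt; omega)
    rw [winN_succ_pair]
    constructor
    · rintro h ⟨hAB, hA⟩
      lift g A to ℕ using hA with a ha
      obtain ⟨hA1, hA2, -⟩ := (g_eq_coe_iff A a).1 ha.symm
      obtain ⟨hB1, hB2, -⟩ := (g_eq_coe_iff B a).1 hAB.symm
      rcases h with (⟨A', h, hw⟩ | ⟨B', h, hw⟩) | (⟨A', h, hw⟩ | ⟨B', h, hw⟩)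
      · rw [qA A' h, not_not] at hw
        exact hA2 A' h (hw.1.trans hAB.symm)
      · rw [qB B' h, not_not] at hw
        exact hB2 B' h hw.1.symm
      · rw [cA A' h] at hw
        exact hw ⟨(hA1 A' h).trans hAB, by simp [hA1 A' h]⟩
      · rw [cB B' h] at hw
        exact hw ⟨(hB1 B' h).symm, by simp⟩
    · intro h
      by_contra hw
      push Not at hw
      obtain ⟨⟨wqA, wqB⟩, wcA, wcB⟩ := hw
      obtain ⟨hA, hAB⟩ := g_le_of_forall_option (L := A) (v := g B)
        (fun A' h hg => by have := (qA A' h).1 (wqA A' h); tauto)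
        (fun A' h => by have := wcA A' h; rw [cA A' h] at this; tauto)
      obtain ⟨-, hBA⟩ := g_le_of_forall_option (L := B) (v := g A)
        (fun B' h hg => by have := (qB B' h).1 (wqB B' h); rw [hg]; tauto)
        (fun B' h => by
          have := wcB B' h
          rw [cB B' h, not_not] at this
          exact ⟨this.1.symm, this.1 ▸ this.2⟩)
      exact h ⟨hAB.antisymm hBA, hA⟩

theorem getElem?_bulbs_sockets_append (k m i : ℕ) (X : Component) :
    (bulbs k ++ sockets m ++ X)[i]? =
      if i < k then some Piece.bulb else if i < k + m then some Piece.socket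
      else X[i - (k + m)]? := by
  simp only [bulbs, sockets, List.getElem?_append, List.length_append, List.length_replicate,
    List.getElem?_replicate]
  split_ifs <;> first | rfl | omega

theorem BulbHeaded.getElem?_zero {X : Component} (hX : BulbHeaded X) :
    X[0]? = if X = [] then none else some Piece.bulb := by
  rcases X with _ | ⟨a, X⟩
  · rfl
  · rcases hX with h | h <;> simp_all

theorem BulbHeaded.sandwiched_append_iff {X : Component} (hX : BulbHeaded X) (k m i : ℕ)
    (hi : X[i]? = some Piece.socket) :
    Sandwiched (bulbs k ++ sockets m ++ X) (k + m + i) ↔ Sandwiched X i := by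
  have hpos : 0 < i := by
    rcases Nat.eq_zero_or_pos i with rfl | h
    · rw [hX.getElem?_zero] at hi
      split_ifs at hi
      simp at hi
    · exact h
  simp only [Sandwiched, getElem?_bulbs_sockets_append]
  rw [if_neg (by omega), if_neg (by omega), if_neg (by omega), if_neg (by omega),
    show k + m + i - 1 - (k + m) = i - 1 by omega, show k + m + i + 1 - (k + m) = i + 1 by omega]
  simp [hpos, show 0 < k + m + i by omega]

theorem BulbHeaded.sandwiched_sockets_iff {X : Component} (hX : BulbHeaded X) (k m i : ℕ)
    (hi : i < m) :
    Sandwiched (bulbs k ++ sockets m ++ X) (k + i) ↔ k ≠ 0 ∧ m = 1 ∧ X ≠ [] := by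
  simp only [Sandwiched, getElem?_bulbs_sockets_append]
  by_cases hm : m = 1
  · obtain rfl : i = 0 := by omega
    subst hm
    rw [if_neg (by omega : ¬ k + 0 + 1 < k), if_neg (by omega : ¬ k + 0 + 1 < k + 1),
      show k + 0 + 1 - (k + 1) = 0 by omega, hX.getElem?_zero]
    by_cases hk : k = 0 <;> by_cases hX0 : X = [] <;> simp [hk, hX0]; omega
  · simp only [hm, false_and, and_false, iff_false]
    rintro ⟨h0, h1, h2⟩
    split_ifs at h1 h2 <;> first | omega | (cases h1; done) | cases h2

theorem eraseIdx_bulbs_sockets_append (k m i : ℕ) (X : Component) :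
    (bulbs k ++ sockets m ++ X).eraseIdx (k + m + i) = bulbs k ++ sockets m ++ X.eraseIdx i := by
  rw [List.eraseIdx_append_of_length_le (by simp [bulbs, sockets])]
  simp [bulbs, sockets]

theorem eraseIdx_sockets (k m i : ℕ) (X : Component) (hi : i < m) :
    (bulbs k ++ sockets m ++ X).eraseIdx (k + i) = bulbs k ++ sockets (m - 1) ++ X := by
  rw [List.append_assoc, List.eraseIdx_append_of_length_le (by simp [bulbs]),
    List.eraseIdx_append_of_lt_length (by simpa [bulbs, sockets] using hi)]
  simp [bulbs, sockets, List.eraseIdx_replicate, hi]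

theorem take_bulbs_sockets_append (k m i : ℕ) (X : Component) :
    (bulbs k ++ sockets m ++ X).take (k + m + i) = bulbs k ++ sockets m ++ X.take i := by
  rw [List.take_append, List.take_of_length_le (by simp [bulbs, sockets])]
  simp [bulbs, sockets]

theorem take_bulbs_append {k m j : ℕ} {X : Component} (hj : j < k) :
    (bulbs k ++ sockets m ++ X).take j = bulbs j := by
  rw [List.append_assoc, List.take_append_of_le_length (by simp [bulbs]; omega)]
  simp [bulbs, hj.le]

theorem QuietOption.bulbHeaded {X Y : Component} (hX : BulbHeaded X) (h : QuietOption X Y) :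
    BulbHeaded Y := by
  rcases X with _ | ⟨a, X⟩
  · simpa using h.length_lt
  obtain rfl : a = Piece.bulb := by simpa [BulbHeaded] using hX
  rcases h with ⟨_ | i, hi, rfl⟩ | ⟨_ | i, hi, -, rfl⟩ <;> simp_all [BulbHeaded]

theorem CarryOption.bulbHeaded {X Y : Component} (hX : BulbHeaded X) (h : CarryOption X Y) :
    BulbHeaded Y := by
  rcases X with _ | ⟨a, X⟩
  · simpa using h.length_lt
  obtain rfl : a = Piece.bulb := by simpa [BulbHeaded] using hX
  obtain ⟨_ | i, hi, -, rfl⟩ := h <;> simp_all [BulbHeaded]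

theorem getElem?_bulbs_sockets_append_add (k m i : ℕ) (X : Component) :
    (bulbs k ++ sockets m ++ X)[k + m + i]? = X[i]? := by
  rw [getElem?_bulbs_sockets_append, if_neg (by omega), if_neg (by omega), Nat.add_sub_cancel_left]

theorem getElem?_sockets {k m i : ℕ} (X : Component) (hi : i < m) :
    (bulbs k ++ sockets m ++ X)[k + i]? = some Piece.socket := by
  rw [getElem?_bulbs_sockets_append, if_neg (by omega), if_pos (by omega)]

/-- An index of `bulbs k ++ sockets m ++ X` lies in exactly one of the three blocks. -/
theorem block_cases (k m i : ℕ) :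
    i < k ∨ (∃ j < m, i = k + j) ∨ ∃ j, i = k + m + j := by
  by_cases h1 : i < k
  · exact .inl h1
  by_cases h2 : i < k + m
  · exact .inr (.inl ⟨i - k, by omega, by omega⟩)
  · exact .inr (.inr ⟨i - (k + m), by omega⟩)

theorem BulbHeaded.quietOption_append_iff {X : Component} (hX : BulbHeaded X) (k m : ℕ)
    (Z : Component) :
    QuietOption (bulbs k ++ sockets m ++ X) Z ↔
      (∃ j < k, Z = bulbs j) ∨
      (m ≠ 0 ∧ ¬ (k ≠ 0 ∧ m = 1 ∧ X ≠ []) ∧ Z = bulbs k ++ sockets (m - 1) ++ X) ∨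
      ∃ Y, QuietOption X Y ∧ Z = bulbs k ++ sockets m ++ Y := by
  constructor
  · rintro (⟨i, hi, rfl⟩ | ⟨i, hi, hs, rfl⟩)
    · rcases block_cases k m i with h | ⟨j, hj, rfl⟩ | ⟨j, rfl⟩
      · exact .inl ⟨i, h, take_bulbs_append h⟩
      · rw [getElem?_sockets X hj] at hi; cases hi
      · rw [getElem?_bulbs_sockets_append_add] at hi
        exact .inr (.inr ⟨_, .inl ⟨j, hi, rfl⟩, take_bulbs_sockets_append k m j X⟩)
    · rcases block_cases k m i with h | ⟨j, hj, rfl⟩ | ⟨j, rfl⟩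
      · rw [getElem?_bulbs_sockets_append, if_pos h] at hi; cases hi
      · rw [hX.sandwiched_sockets_iff k m j hj] at hs
        exact .inr (.inl ⟨by omega, hs, eraseIdx_sockets k m j X hj⟩)
      · rw [getElem?_bulbs_sockets_append_add] at hi
        rw [hX.sandwiched_append_iff k m j hi] at hs
        exact .inr (.inr ⟨_, .inr ⟨j, hi, hs, rfl⟩, eraseIdx_bulbs_sockets_append k m j X⟩)
  · rintro (⟨j, hj, rfl⟩ | ⟨hm, hs, rfl⟩ | ⟨Y, ⟨j, hi, rfl⟩ | ⟨j, hi, hs, rfl⟩, rfl⟩)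
    · exact .inl ⟨j, by rw [getElem?_bulbs_sockets_append, if_pos hj], (take_bulbs_append hj).symm⟩
    · have h0 : 0 < m := by omega
      exact .inr ⟨k + 0, getElem?_sockets X h0, by rwa [hX.sandwiched_sockets_iff k m 0 h0],
        (eraseIdx_sockets k m 0 X h0).symm⟩
    · exact .inl ⟨k + m + j, by rwa [getElem?_bulbs_sockets_append_add],
        (take_bulbs_sockets_append k m j X).symm⟩
    · exact .inr ⟨k + m + j, by rwa [getElem?_bulbs_sockets_append_add],
        by rwa [hX.sandwiched_append_iff k m j hi], (eraseIdx_bulbs_sockets_append k m j X).symm⟩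

theorem BulbHeaded.carryOption_append_iff {X : Component} (hX : BulbHeaded X) (k m : ℕ)
    (Z : Component) :
    CarryOption (bulbs k ++ sockets m ++ X) Z ↔
      ((k ≠ 0 ∧ m = 1 ∧ X ≠ []) ∧ Z = bulbs k ++ sockets (m - 1) ++ X) ∨
      ∃ Y, CarryOption X Y ∧ Z = bulbs k ++ sockets m ++ Y := by
  constructor
  · rintro ⟨i, hi, hs, rfl⟩
    rcases block_cases k m i with h | ⟨j, hj, rfl⟩ | ⟨j, rfl⟩
    · rw [getElem?_bulbs_sockets_append, if_pos h] at hi; cases hi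
    · rw [hX.sandwiched_sockets_iff k m j hj] at hs
      exact .inl ⟨hs, eraseIdx_sockets k m j X hj⟩
    · rw [getElem?_bulbs_sockets_append_add] at hi
      rw [hX.sandwiched_append_iff k m j hi] at hs
      exact .inr ⟨_, ⟨j, hi, hs, rfl⟩, eraseIdx_bulbs_sockets_append k m j X⟩
  · rintro (⟨hs, rfl⟩ | ⟨Y, ⟨j, hi, hs, rfl⟩, rfl⟩)
    · have h0 : 0 < m := by omega
      exact ⟨k + 0, getElem?_sockets X h0, by rwa [hX.sandwiched_sockets_iff k m 0 h0],
        (eraseIdx_sockets k m 0 X h0).symm⟩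
    · exact ⟨k + m + j, by rwa [getElem?_bulbs_sockets_append_add],
        by rwa [hX.sandwiched_append_iff k m j hi], (eraseIdx_bulbs_sockets_append k m j X).symm⟩

theorem g_bulbs (k : ℕ) : g (bulbs k) = k := by
  induction k using Nat.strong_induction_on with
  | _ k ih =>
    have hnil : BulbHeaded [] := .inl rfl
    have hq := hnil.quietOption_append_iff k 0
    have hc := hnil.carryOption_append_iff k 0
    simp only [sockets, List.replicate_zero, List.append_nil, not_quietOption_nil,
      not_carryOption_nil, false_and, exists_false, or_false, ne_eq, not_true_eq_false,
      and_false, zero_ne_one] at hq hc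
    refine (g_eq_coe_iff _ _).2 ⟨fun L' h => absurd h (by simp [hc]), fun L' h => ?_, .inr ?_⟩
    · obtain ⟨j, hj, rfl⟩ := (hq L').1 h
      rw [ih j hj]
      exact_mod_cast hj.ne
    · exact fun j hj => ⟨bulbs j, (hq _).2 ⟨j, hj, rfl⟩, ih j hj⟩

theorem BulbHeaded.quietOption_nil {X : Component} (hX : BulbHeaded X) (h : X ≠ []) :
    QuietOption X [] := by
  refine .inl ⟨0, ?_, by simp⟩
  rw [hX.getElem?_zero, if_neg h]

theorem BulbHeaded.g_ne_zero {X : Component} (hX : BulbHeaded X) (h : X ≠ []) : g X ≠ 0 :=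
  fun h0 => ((g_eq_coe_iff X 0).1 h0).2.1 [] (hX.quietOption_nil h) (g_bulbs 0)

/-- The extended Grundy value of `bulbs k ++ sockets m ++ X` for bulb-headed `X` of finite value
`i` is `k + headPerm k m i`, apart from the case `k ≠ 0`, `m = 1`, `i = 1`. -/
def headPerm (k m i : ℕ) : ℕ :=
  if m = 0 ∨ (k = 0 ∧ m % 2 = 0) ∨ (k ≠ 0 ∧ (m % 2 = 0 ↔ i ≤ 1)) then i
  else if i % 2 = 0 then i + 1 else i - 1

theorem headPerm_involutive (k m : ℕ) : Function.Involutive (headPerm k m) := by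
  intro i
  simp only [headPerm]
  split_ifs <;> omega

/-- The extended Grundy value of `bulbs k ++ sockets m ++ X` for bulb-headed `X` of value `v`. -/
noncomputable def headGrundy (k m : ℕ) (v : ℕ∞) : ℕ∞ :=
  if v = ⊤ ∨ (k ≠ 0 ∧ m = 1 ∧ v = 1) then ⊤ else ((k + headPerm k m v.toNat : ℕ) : ℕ∞)

theorem headGrundy_top (k m : ℕ) : headGrundy k m ⊤ = ⊤ := by
  simp [headGrundy]

theorem headGrundy_coe (k m i : ℕ) : headGrundy k m i =
    if k ≠ 0 ∧ m = 1 ∧ i = 1 then ⊤ else ((k + headPerm k m i : ℕ) : ℕ∞) := by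
  simp [headGrundy]

theorem headGrundy_eq_coe_iff {k m : ℕ} (h : ¬ (k ≠ 0 ∧ m = 1)) (v : ℕ∞) (i : ℕ) :
    headGrundy k m v = ((k + headPerm k m i : ℕ) : ℕ∞) ↔ v = i := by
  induction v using ENat.recTopCoe with
  | top =>
    rw [headGrundy_top]
    exact iff_of_false (ENat.top_ne_natCast _) (ENat.top_ne_natCast _)
  | coe j =>
    rw [headGrundy_coe, if_neg (by tauto), Nat.cast_inj, Nat.cast_inj, Nat.add_left_cancel_iff,
      (headPerm_involutive k m).injective.eq_iff]

theorem headGrundy_pred_ne {k m : ℕ} (hm : m ≠ 0) (h : ¬ (k ≠ 0 ∧ m = 1)) (i : ℕ) :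
    headGrundy k (m - 1) i ≠ ((k + headPerm k m i : ℕ) : ℕ∞) := by
  rw [headGrundy_coe]
  split_ifs with h1
  · exact ENat.top_ne_natCast _
  · rw [ne_eq, Nat.cast_inj]
    simp only [headPerm]
    split_ifs <;> omega

theorem lt_of_lt_headPerm {k m i j : ℕ} (hj : j < headPerm k m i) :
    (m ≠ 0 ∧ headGrundy k (m - 1) i = ((k + j : ℕ) : ℕ∞)) ∨ headPerm k m j < i := by
  rw [headGrundy_coe, or_iff_not_imp_right]
  intro hlt
  have key : m ≠ 0 ∧ ¬ (k ≠ 0 ∧ m - 1 = 1 ∧ i = 1) ∧ headPerm k (m - 1) i = j := by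
    simp only [headPerm] at hj hlt ⊢
    split_ifs at hj hlt ⊢ <;> omega
  rw [if_neg key.2.1, key.2.2]
  exact ⟨key.1, rfl⟩

theorem g_bulbs_sockets_append_of_not {k m : ℕ} (hkm : ¬ (k ≠ 0 ∧ m = 1))
    (hprev : m ≠ 0 → ∀ X, BulbHeaded X →
      g (bulbs k ++ sockets (m - 1) ++ X) = headGrundy k (m - 1) (g X))
    (X : Component) (hX : BulbHeaded X) :
    g (bulbs k ++ sockets m ++ X) = headGrundy k m (g X) := by
  induction hlen : X.length using Nat.strong_induction_on generalizing X with
  | _ l ih =>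
    subst hlen
    have ihq : ∀ Y, QuietOption X Y → g (bulbs k ++ sockets m ++ Y) = headGrundy k m (g Y) :=
      fun Y h => ih _ h.length_lt Y (h.bulbHeaded hX) rfl
    have ihc : ∀ Y, CarryOption X Y → g (bulbs k ++ sockets m ++ Y) = headGrundy k m (g Y) :=
      fun Y h => ih _ h.length_lt Y (h.bulbHeaded hX) rfl
    have hq := hX.quietOption_append_iff k m
    have hc := hX.carryOption_append_iff k m
    by_cases htop : g X = ⊤
    · rw [htop, headGrundy_top]
      by_contra hfin
      lift g (bulbs k ++ sockets m ++ X) to ℕ using hfin with n hn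
      obtain ⟨h1, h2, -⟩ := (g_eq_coe_iff _ _).1 hn.symm
      obtain ⟨Y, hY⟩ := exists_carryOption_of_g_eq_top htop
      have hYn := h1 _ ((hc _).2 (.inr ⟨Y, hY, rfl⟩))
      rw [ihc Y hY] at hYn
      have hYfin : g Y ≠ ⊤ := by
        intro h
        rw [h, headGrundy_top] at hYn
        exact ENat.top_ne_natCast _ hYn
      lift g Y to ℕ using hYfin with i
      rw [headGrundy_coe, if_neg (by tauto), Nat.cast_inj] at hYn
      subst hYn
      refine ENat.top_ne_natCast i (htop.symm.trans ((g_eq_coe_iff X i).2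
        ⟨fun Z hZ => ?_, fun Z hZ h => ?_, .inl ⟨Y, hY⟩⟩))
      · rw [← headGrundy_eq_coe_iff hkm, ← ihc Z hZ]
        exact h1 _ ((hc _).2 (.inr ⟨Z, hZ, rfl⟩))
      · rw [← headGrundy_eq_coe_iff hkm, ← ihq Z hZ] at h
        exact h2 _ ((hq _).2 (.inr (.inr ⟨Z, hZ, rfl⟩))) h
    · lift g X to ℕ using htop with i hi
      obtain ⟨h1, h2, h3⟩ := (g_eq_coe_iff _ _).1 hi.symm
      rw [headGrundy_coe, if_neg (by tauto)]
      refine (g_eq_coe_iff _ _).2 ⟨fun Z hZ => ?_, fun Z hZ => ?_, ?_⟩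
      · rcases (hc Z).1 hZ with ⟨h, -⟩ | ⟨Y, hY, rfl⟩
        · tauto
        · rw [ihc Y hY, headGrundy_eq_coe_iff hkm]
          exact h1 Y hY
      · rcases (hq Z).1 hZ with ⟨j, hj, rfl⟩ | ⟨hm, -, rfl⟩ | ⟨Y, hY, rfl⟩
        · rw [g_bulbs, ne_eq, Nat.cast_inj]
          omega
        · rw [hprev hm X hX, ← hi]
          exact headGrundy_pred_ne hm hkm i
        · rw [ihq Y hY, ne_eq, headGrundy_eq_coe_iff hkm]
          exact h2 Y hY
      · rcases h3 with ⟨Y, hY⟩ | h3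
        · exact .inl ⟨_, (hc _).2 (.inr ⟨Y, hY, rfl⟩)⟩
        refine .inr fun j hj => ?_
        by_cases hjk : j < k
        · exact ⟨_, (hq _).2 (.inl ⟨j, hjk, rfl⟩), g_bulbs j⟩
        obtain ⟨t, rfl⟩ := Nat.exists_eq_add_of_le (not_lt.1 hjk)
        rcases lt_of_lt_headPerm (Nat.lt_of_add_lt_add_left hj) with ⟨hm, h⟩ | h
        · exact ⟨_, (hq _).2 (.inr (.inl ⟨hm, by tauto, rfl⟩)), by rw [hprev hm X hX, ← hi, h]⟩
        · obtain ⟨Y, hY, hgY⟩ := h3 _ h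
          refine ⟨_, (hq _).2 (.inr (.inr ⟨Y, hY, rfl⟩)), ?_⟩
          rw [ihq Y hY, hgY, headGrundy_coe, if_neg (by tauto), headPerm_involutive]

theorem g_bulbs_socket_append {k : ℕ} (hk : k ≠ 0)
    (hprev : ∀ X, BulbHeaded X → g (bulbs k ++ sockets 0 ++ X) = headGrundy k 0 (g X))
    (X : Component) (hX : BulbHeaded X) :
    g (bulbs k ++ sockets 1 ++ X) = headGrundy k 1 (g X) := by
  have hnil : g (bulbs k ++ sockets 1 ++ []) = ((k + 1 : ℕ) : ℕ∞) := by
    have hq := BulbHeaded.quietOption_append_iff (.inl rfl : BulbHeaded []) k 1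
    have hc := BulbHeaded.carryOption_append_iff (.inl rfl : BulbHeaded []) k 1
    have hk0 : bulbs k ++ sockets (1 - 1) ++ [] = bulbs k := by simp [sockets]
    rw [hk0] at hq hc
    refine (g_eq_coe_iff _ _).2 ⟨fun Z hZ => ?_, fun Z hZ => ?_, .inr fun j hj => ?_⟩
    · rcases (hc Z).1 hZ with ⟨⟨-, -, h⟩, -⟩ | ⟨Y, hY, -⟩
      · exact absurd rfl h
      · exact absurd hY (not_carryOption_nil Y)
    · rcases (hq Z).1 hZ with ⟨j, hj, rfl⟩ | ⟨-, -, rfl⟩ | ⟨Y, hY, -⟩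
      · rw [g_bulbs, ne_eq, Nat.cast_inj]
        omega
      · rw [g_bulbs, ne_eq, Nat.cast_inj]
        omega
      · exact absurd hY (not_quietOption_nil Y)
    · refine ⟨bulbs j, (hq _).2 ?_, g_bulbs j⟩
      rcases Nat.lt_succ_iff_lt_or_eq.1 hj with h | rfl
      · exact .inl ⟨j, h, rfl⟩
      · exact .inr (.inl ⟨one_ne_zero, by simp, rfl⟩)
  induction hlen : X.length using Nat.strong_induction_on generalizing X with
  | _ l ih =>
    subst hlen
    by_cases hX0 : X = []
    · subst hX0
      have h0 : g [] = ((0 : ℕ) : ℕ∞) := g_bulbs 0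
      rw [hnil, h0, headGrundy_coe, if_neg (by simp)]
      simp [headPerm, hk]
    have ihq : ∀ Y, QuietOption X Y → g (bulbs k ++ sockets 1 ++ Y) = headGrundy k 1 (g Y) :=
      fun Y h => ih _ h.length_lt Y (h.bulbHeaded hX) rfl
    have ihc : ∀ Y, CarryOption X Y → g (bulbs k ++ sockets 1 ++ Y) = headGrundy k 1 (g Y) :=
      fun Y h => ih _ h.length_lt Y (h.bulbHeaded hX) rfl
    have hq := hX.quietOption_append_iff k 1
    have hc := hX.carryOption_append_iff k 1
    have hbase : CarryOption (bulbs k ++ sockets 1 ++ X) (bulbs k ++ sockets 0 ++ X) :=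
      (hc _).2 (.inl ⟨⟨hk, rfl, hX0⟩, rfl⟩)
    by_cases hfin : g X = ⊤ ∨ g X = 1
    · rw [headGrundy, if_pos (by tauto)]
      by_contra hne
      lift g (bulbs k ++ sockets 1 ++ X) to ℕ using hne with n hn
      obtain ⟨h1, h2, -⟩ := (g_eq_coe_iff _ _).1 hn.symm
      have h := h1 _ hbase
      rw [hprev X hX] at h
      rcases hfin with htop | hone
      · rw [htop, headGrundy_top] at h
        exact ENat.top_ne_natCast _ h
      · refine h2 _ ((hq _).2 (.inr (.inr ⟨[], hX.quietOption_nil hX0, rfl⟩))) ?_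
        rw [hnil, ← h, hone, headGrundy, if_neg (by simp)]
        simp [headPerm]
    · push Not at hfin
      obtain ⟨htop, hone⟩ := hfin
      have hzero := hX.g_ne_zero hX0
      lift g X to ℕ using htop with i hi
      have hi2 : 2 ≤ i := by
        have h0 : i ≠ 0 := by exact_mod_cast hzero
        have h1 : i ≠ 1 := by exact_mod_cast hone
        omega
      have hperm : headPerm k 1 i = i := if_pos (by omega)
      have heq : ∀ v : ℕ∞, headGrundy k 1 v = ((k + i : ℕ) : ℕ∞) ↔ v = i := by
        intro v
        induction v using ENat.recTopCoe with
        | top =>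
          rw [headGrundy_top]
          exact iff_of_false (ENat.top_ne_natCast _) (ENat.top_ne_natCast _)
        | coe j =>
          rw [headGrundy_coe, Nat.cast_inj]
          split_ifs with h
          · exact iff_of_false (ENat.top_ne_natCast _) (by omega)
          · rw [Nat.cast_inj, Nat.add_left_cancel_iff]
            nth_rewrite 1 [← hperm]
            exact (headPerm_involutive k 1).injective.eq_iff
      obtain ⟨h1, h2, -⟩ := (g_eq_coe_iff _ _).1 hi.symm
      rw [(heq i).2 rfl]
      refine (g_eq_coe_iff _ _).2 ⟨fun Z hZ => ?_, fun Z hZ => ?_, .inl ⟨_, hbase⟩⟩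
      · rcases (hc Z).1 hZ with ⟨-, rfl⟩ | ⟨Y, hY, rfl⟩
        · rw [Nat.sub_self, hprev X hX, ← hi, headGrundy_coe, if_neg (by simp), headPerm,
            if_pos (.inl rfl)]
        · rw [ihc Y hY, heq]
          exact h1 Y hY
      · rcases (hq Z).1 hZ with ⟨j, hj, rfl⟩ | ⟨-, h, -⟩ | ⟨Y, hY, rfl⟩
        · rw [g_bulbs, ne_eq, Nat.cast_inj]
          omega
        · exact absurd ⟨hk, trivial, hX0⟩ h
        · rw [ihq Y hY, ne_eq, heq]
          exact h2 Y hY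

/-- The extended Grundy value of `bulbs k ++ sockets m ++ X` depends only on that of `X`. -/
theorem g_bulbs_sockets_append (k m : ℕ) (X : Component) (hX : BulbHeaded X) :
    g (bulbs k ++ sockets m ++ X) = headGrundy k m (g X) := by
  induction m generalizing X with
  | zero => exact g_bulbs_sockets_append_of_not (by simp) (by simp) X hX
  | succ m ih =>
    by_cases hkm : k ≠ 0 ∧ m + 1 = 1
    · obtain rfl : m = 0 := by omega
      exact g_bulbs_socket_append hkm.1 ih X hX
    · exact g_bulbs_sockets_append_of_not hkm (fun _ => ih) X hX

/-- Let `X` and `X'` be bulb-headed components with the same finite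
extended Grundy value `i`, and suppose `g (bulb^k ++ socket^m ++ X)` is finite.
Then the two-component position consisting of `bulb^k ++ socket^m ++ X` and
`bulb^k ++ socket^m ++ X'` is a previous-player win. -/
theorem stmt7 (k m i : ℕ) (X X' : Component)
    (hX : BulbHeaded X) (hX' : BulbHeaded X')
    (hgX : g X = (i : ℕ∞)) (hgX' : g X' = (i : ℕ∞))
    (hfin : g (bulbs k ++ sockets m ++ X) ≠ ⊤) :
    ¬ Win {bulbs k ++ sockets m ++ X, bulbs k ++ sockets m ++ X'} := by
  rw [Win, winN_pair_iff _ _ _ (by simp [Position.size]), not_not]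
  refine ⟨?_, hfin⟩
  rw [g_bulbs_sockets_append k m X hX, g_bulbs_sockets_append k m X' hX', hgX, hgX']
end
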